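/- For each integer s ≥ 8, each curve of 𝒞^s covers some cube P_{x,2^{s−8}} with x ∈ ℤ^3, i.e. every segment containing a point of P_{x,2^{s−8}} is a segment of that curve. -/

import Mathlib

namespace Folding

noncomputable section

open Set

/-- Points of `ℝ^n` with the euclidean distance. -/
abbrev Pt (n : ℕ) := EuclideanSpace ℝ (Fin n)

/-- `p` is a point of the lattice `ℤ^n`. -/
def latt {n : ℕ} (p : Pt n) : Prop := ∀ i, ∃ m : ℤ, p i = (m : ℝ)

/-- `p` belongs to `m·ℤ^n`. -/
def inLat {n : ℕ} (m : ℕ) (p : Pt n) : Prop := ∀ i, ∃ c : ℤ, p i = (m : ℝ) * (c : ℝ)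

/-- The canonical basis vector `e_i`. -/
def uvec (n : ℕ) (i : Fin n) : Pt n := EuclideanSpace.single i (1 : ℝ)

/-- `u` belongs to `E = {e_1, -e_1, …, e_n, -e_n}`. -/
def IsDir {n : ℕ} (u : Pt n) : Prop := ∃ i, u = uvec n i ∨ u = -uvec n i

/-- A (nonoriented) lattice segment `[x, x + e_i]`, as an unordered pair of endpoints. -/
def IsSeg {n : ℕ} (S : Sym2 (Pt n)) : Prop := ∃ x i, latt x ∧ S = s(x, x + uvec n i)

/-- A curve: a sequence of segments, indexed by an interval of `ℤ` (finite, ℕ-like or ℤ-like),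
recorded through its sequence of vertices; two consecutive segments have exactly one common
endpoint, and the common endpoints with the preceding and the following segments differ
(`noback`). -/
structure Curve (n : ℕ) where
  dom : Set ℤ
  ordConn : dom.OrdConnected
  nontriv : ∃ i, i ∈ dom ∧ i + 1 ∈ dom
  v : ℤ → Pt n
  lattice : ∀ i ∈ dom, latt (v i)
  step : ∀ i : ℤ, i ∈ dom → i + 1 ∈ dom →
    ∃ j, v (i + 1) = v i + uvec n j ∨ v (i + 1) = v i - uvec n j
  noback : ∀ i : ℤ, i - 1 ∈ dom → i + 1 ∈ dom → v (i + 1) ≠ v (i - 1)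

namespace Curve

variable {n : ℕ} (c : Curve n)

/-- The segments of a curve. -/
def segs : Set (Sym2 (Pt n)) :=
  {S | ∃ i : ℤ, i ∈ c.dom ∧ i + 1 ∈ c.dom ∧ S = s(c.v i, c.v (i + 1))}

/-- The connexions between segments of a curve: pairs of consecutive segments. -/
def conn (S T : Sym2 (Pt n)) : Prop :=
  ∃ i : ℤ, i - 1 ∈ c.dom ∧ i + 1 ∈ c.dom ∧
    ((S = s(c.v (i - 1), c.v i) ∧ T = s(c.v i, c.v (i + 1))) ∨
     (T = s(c.v (i - 1), c.v i) ∧ S = s(c.v i, c.v (i + 1))))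

/-- A curve is self-avoiding if each of its segments appears only once. -/
def SelfAvoiding : Prop :=
  ∀ i j : ℤ, i ∈ c.dom → i + 1 ∈ c.dom → j ∈ c.dom → j + 1 ∈ c.dom →
    s(c.v i, c.v (i + 1)) = s(c.v j, c.v (j + 1)) → i = j

/-- A curve without endpoints (indexed by `ℤ`). -/
def NoEndpts : Prop := c.dom = Set.univ

/-- `p` is an endpoint of the curve `c`. -/
def IsEndpt (p : Pt n) : Prop :=
  ∃ i ∈ c.dom, p = c.v i ∧ (i - 1 ∉ c.dom ∨ i + 1 ∉ c.dom)

/-- `S` is the end segment of `c` at its endpoint `p`. -/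
def endSegAt (p : Pt n) (S : Sym2 (Pt n)) : Prop :=
  ∃ i : ℤ, i ∈ c.dom ∧ p = c.v i ∧
    ((i - 1 ∉ c.dom ∧ i + 1 ∈ c.dom ∧ S = s(c.v i, c.v (i + 1))) ∨
     (i + 1 ∉ c.dom ∧ i - 1 ∈ c.dom ∧ S = s(c.v (i - 1), c.v i)))

/-- The number of segments (length) of a curve. -/
def nsegs : ℕ := {i : ℤ | i ∈ c.dom ∧ i + 1 ∈ c.dom}.ncard

end Curve

/-- The trace of a set of curves: its set of segments together with the connexion
relation between segments.  Two sets of curves are geometrically the same set of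
(nonoriented) curves iff they have the same trace. -/
structure Trace (n : ℕ) where
  segs : Set (Sym2 (Pt n))
  conn : Sym2 (Pt n) → Sym2 (Pt n) → Prop

def curveTrace {n : ℕ} (c : Curve n) : Trace n := ⟨c.segs, c.conn⟩

def traceOf {n : ℕ} (E : Set (Curve n)) : Trace n :=
  ⟨{S | ∃ c ∈ E, S ∈ c.segs}, fun S T => ∃ c ∈ E, c.conn S T⟩

/-- Two curves are the same nonoriented curve. -/
def SameCurve {n : ℕ} (c d : Curve n) : Prop := c.segs = d.segs ∧ c.conn = d.conn

/-- A set of pairwise disjoint self-avoiding curves. -/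
def DisjSA {n : ℕ} (E : Set (Curve n)) : Prop :=
  (∀ c ∈ E, c.SelfAvoiding) ∧
  ∀ c ∈ E, ∀ d ∈ E, ¬ SameCurve c d → ∀ S, S ∈ c.segs → S ∉ d.segs

/-- The set of points of `ℝ^n` lying on the segment `S`. -/
def segPts {n : ℕ} (S : Sym2 (Pt n)) : Set (Pt n) :=
  {p | ∃ a b, S = s(a, b) ∧ ∃ t : ℝ, 0 ≤ t ∧ t ≤ 1 ∧ p = a + t • (b - a)}

def Trace.pts {n : ℕ} (T : Trace n) : Set (Pt n) := ⋃ S ∈ T.segs, segPts S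

/-- A set of curves covers `X ⊆ ℝ^n`: each lattice segment containing a point of `X`
appears in one and only one of the curves. -/
def Covers {n : ℕ} (E : Set (Curve n)) (X : Set (Pt n)) : Prop :=
  ∀ S, IsSeg S → (segPts S ∩ X).Nonempty →
    (∃ c ∈ E, S ∈ c.segs) ∧ ∀ c ∈ E, ∀ d ∈ E, S ∈ c.segs → S ∈ d.segs → SameCurve c d

/-- A covering of `ℝ^n` by disjoint self-avoiding curves. -/
def IsCovering {n : ℕ} (E : Set (Curve n)) : Prop := DisjSA E ∧ Covers E Set.univ

/-- A single curve covers `X`. -/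
def CurveCovers {n : ℕ} (c : Curve n) (X : Set (Pt n)) : Prop :=
  ∀ S, IsSeg S → (segPts S ∩ X).Nonempty → S ∈ c.segs

/-- `b` is a curve contained in the curve `a`. -/
def SubCurve {n : ℕ} (b a : Curve n) : Prop :=
  b.segs ⊆ a.segs ∧ ∀ S T, b.conn S T → a.conn S T

/-- The relation `≺` at the level of traces. -/
def TPrec {n : ℕ} (T T' : Trace n) : Prop :=
  T.segs ⊆ T'.segs ∧ ∀ S S', T.conn S S' → T'.conn S S'

/-- `E ≺ F` : each segment of a curve of `E` is a segment of a curve of `F` and each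
connexion between two segments of a curve of `E` also exists in `F`. -/
def Prec {n : ℕ} (E F : Set (Curve n)) : Prop := TPrec (traceOf E) (traceOf F)

/-- Image of a trace under a map of `ℝ^n`. -/
def Trace.map {n : ℕ} (f : Pt n → Pt n) (T : Trace n) : Trace n :=
  ⟨Sym2.map f '' T.segs,
   fun S S' => ∃ A B, T.conn A B ∧ S = Sym2.map f A ∧ S' = Sym2.map f B⟩

/-- Translation of a trace by the vector `t`. -/
def Trace.transl {n : ℕ} (t : Pt n) (T : Trace n) : Trace n := T.map (fun p => p + t)

/-- Property (H) for the pair `(k, l)`. -/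
def SatH {n : ℕ} (A : Set (Curve n)) (k l : ℕ) : Prop :=
  0 < k ∧ 0 < l ∧ k ∣ l ∧ IsCovering A ∧
  (∀ c ∈ A, c.dom.Finite ∧ ∃ x i, latt x ∧ inLat k x ∧ c.IsEndpt x ∧
      c.IsEndpt (x + (k : ℝ) • uvec n i) ∧
      ∀ p, c.IsEndpt p → p = x ∨ p = x + (k : ℝ) • uvec n i) ∧
  (∀ (x : Pt n) (i : Fin n), latt x → inLat k x →
      (∃ c ∈ A, c.IsEndpt x ∧ c.IsEndpt (x + (k : ℝ) • uvec n i)) ∧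
      ∀ c ∈ A, ∀ d ∈ A, c.IsEndpt x → c.IsEndpt (x + (k : ℝ) • uvec n i) →
        d.IsEndpt x → d.IsEndpt (x + (k : ℝ) • uvec n i) → SameCurve c d) ∧
  (∀ t : Pt n, inLat l t → Trace.transl t (traceOf A) = traceOf A)

/-- The trace of the convolution product `A ∗ B`, where `A` satisfies (H) for `(k, l)`:
apply to `B` the homothety of center `0` and ratio `k`, then replace each resulting
segment by the curve of `A` having the same endpoints (connexions come from the curves
of `A`, together with the junctions of the end segments of consecutive `A`-curves). -/
def ConvTrace {n : ℕ} (k : ℕ) (A B : Set (Curve n)) : Trace n where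
  segs := {S | ∃ a b : Pt n, s(a, b) ∈ (traceOf B).segs ∧
    ∃ c ∈ A, c.IsEndpt ((k : ℝ) • a) ∧ c.IsEndpt ((k : ℝ) • b) ∧ S ∈ c.segs}
  conn := fun S S' =>
    (∃ a b : Pt n, s(a, b) ∈ (traceOf B).segs ∧
      ∃ c ∈ A, c.IsEndpt ((k : ℝ) • a) ∧ c.IsEndpt ((k : ℝ) • b) ∧ c.conn S S') ∨
    (∃ a b d : Pt n, (traceOf B).conn s(a, b) s(b, d) ∧
      ∃ c ∈ A, ∃ c' ∈ A, c.IsEndpt ((k : ℝ) • a) ∧ c.IsEndpt ((k : ℝ) • b) ∧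
        c'.IsEndpt ((k : ℝ) • b) ∧ c'.IsEndpt ((k : ℝ) • d) ∧
        ((c.endSegAt ((k : ℝ) • b) S ∧ c'.endSegAt ((k : ℝ) • b) S') ∨
         (c.endSegAt ((k : ℝ) • b) S' ∧ c'.endSegAt ((k : ℝ) • b) S)))

/-- The two-sided identity of the convolution product: the covering consisting of all
curves with one segment. -/
def unitTrace (n : ℕ) : Trace n := ⟨{S | IsSeg S}, fun _ _ => False⟩

/-- `P s` realizes the power `A^s` for the convolution product. -/
def PowersOf {n : ℕ} (A : Set (Curve n)) (k : ℕ) (P : ℕ → Set (Curve n)) : Prop :=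
  (∀ s, DisjSA (P s)) ∧ traceOf (P 0) = unitTrace n ∧
  ∀ s, traceOf (P (s + 1)) = ConvTrace k A (P s)

/-- The trace of `Â`, the inductive limit of the `A^s` for `≺`. -/
def hatTrace {n : ℕ} (P : ℕ → Set (Curve n)) : Trace n :=
  ⟨{S | ∃ s, S ∈ (traceOf (P s)).segs}, fun S T => ∃ s, (traceOf (P s)).conn S T⟩

/-- A pairing relation on `E = {e_1, -e_1, …, e_n, -e_n}`. -/
def IsPairing {n : ℕ} (R : Pt n → Pt n → Prop) : Prop :=
  (∀ u v, R u v → R v u) ∧ (∀ u v, R u v → IsDir u ∧ IsDir v) ∧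
  (∀ u, ¬ R u u) ∧ ∀ u, IsDir u → ∃! v, R u v

/-- The trace of `Â_R` : `Â` with the segments with endpoint `0` connected according
to `R`. -/
def hatRTrace {n : ℕ} (P : ℕ → Set (Curve n)) (R : Pt n → Pt n → Prop) : Trace n :=
  ⟨(hatTrace P).segs,
   fun S T => (hatTrace P).conn S T ∨
     ∃ u v, R u v ∧ S = s((0 : Pt n), u) ∧ T = s((0 : Pt n), v)⟩

/-- The cube `P_{x,h}`. -/
def cube {n : ℕ} (x : Pt n) (h : ℕ) : Set (Pt n) :=
  {p | ∀ i, x i - h ≤ p i ∧ p i ≤ x i + h}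

/-- Restriction of a trace to a region `X` of `ℝ^n`. -/
def Trace.restr {n : ℕ} (T : Trace n) (X : Set (Pt n)) : Trace n :=
  ⟨{S | S ∈ T.segs ∧ segPts S ⊆ X},
   fun S S' => T.conn S S' ∧ segPts S ⊆ X ∧ segPts S' ⊆ X⟩

/-- Condition (C). -/
def CondC {n : ℕ} (T : Trace n) : Prop :=
  ∀ (x : Pt n) (h : ℕ), latt x → 1 ≤ h →
    ∃ y : Pt n, latt y ∧ y ∉ cube x h ∧
      Trace.transl (y - x) (T.restr (cube x h)) = T.restr (cube y h)

/-- `(B(x,r) ∩ T, x) ≅ (B(y,r) ∩ T', y)` : the translation sending `x` to `y` maps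
the part of `T` in the closed ball `B(x,r)` onto the part of `T'` in `B(y,r)`,
preserving the connexions between segments. -/
def BallIso {n : ℕ} (T : Trace n) (x : Pt n) (T' : Trace n) (y : Pt n) (r : ℝ) : Prop :=
  (fun p => p + (y - x)) '' (T.pts ∩ Metric.closedBall x r) =
      T'.pts ∩ Metric.closedBall y r ∧
  (∀ S S', T.conn S S' → segPts S ⊆ Metric.closedBall x r →
      segPts S' ⊆ Metric.closedBall x r →
      T'.conn (Sym2.map (fun p => p + (y - x)) S) (Sym2.map (fun p => p + (y - x)) S')) ∧
  (∀ S S', T'.conn S S' → segPts S ⊆ Metric.closedBall y r →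
      segPts S' ⊆ Metric.closedBall y r →
      T.conn (Sym2.map (fun p => p + (x - y)) S) (Sym2.map (fun p => p + (x - y)) S'))

/-- The local isomorphism property. -/
def LocIsoProp {n : ℕ} (T : Trace n) : Prop :=
  ∀ (x : Pt n) (r : ℝ), 0 ≤ r →
    ∃ t : ℝ, 0 ≤ t ∧ ∀ y : Pt n, ∃ z ∈ Metric.closedBall y t, BallIso T x T z r

/-- Two traces are locally isomorphic. -/
def LocallyIso {n : ℕ} (T T' : Trace n) : Prop :=
  (∀ (x : Pt n) (r : ℝ), 0 ≤ r → ∃ y, BallIso T x T' y r) ∧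
  (∀ (y : Pt n) (r : ℝ), 0 ≤ r → ∃ x, BallIso T' y T x r)

/-- `Ω_{s,x}` : suppress the connexions between segments whose common endpoint lies in
`x + k^s ℤ^n`. -/
def OmegaTrace {n : ℕ} (k s : ℕ) (x : Pt n) (T : Trace n) : Trace n :=
  ⟨T.segs, fun S S' => T.conn S S' ∧ ¬ ∃ p, p ∈ S ∧ p ∈ S' ∧ inLat (k ^ s) (p - x)⟩

/-- `Σ_{s,x}(E)` : for each curve `D` of `E` passing through `x`, the curve(s) with
endpoint `x` contained in `D` having maximal length, this length being limited to
`8^s`. -/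
def SigmaSet {n : ℕ} (s : ℕ) (x : Pt n) (E : Set (Curve n)) : Set (Curve n) :=
  {b | ∃ D ∈ E, SubCurve b D ∧ b.IsEndpt x ∧ b.nsegs ≤ 8 ^ s ∧
    ∀ b' : Curve n, SubCurve b' D → b'.IsEndpt x → b'.nsegs ≤ 8 ^ s →
      SubCurve b b' → SameCurve b b'}

/-- A positive (orientation preserving) isometry of `ℝ^n`. -/
def PosIsom {n : ℕ} (f : Pt n → Pt n) : Prop :=
  ∃ (g : Pt n ≃ₗᵢ[ℝ] Pt n) (t : Pt n), (∀ x, f x = g x + t) ∧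
    0 < LinearMap.det (g.toLinearEquiv.toLinearMap)

/-- `E` consists of exactly `m` curves. -/
def HasExactly {n : ℕ} (E : Set (Curve n)) (m : ℕ) : Prop :=
  ∃ L : List (Curve n), L.length = m ∧ (∀ c ∈ L, c ∈ E) ∧
    L.Pairwise (fun c d => ¬ SameCurve c d) ∧ ∀ c ∈ E, ∃ d ∈ L, SameCurve c d

/-- `E` consists of at most `m` curves. -/
def AtMost {n : ℕ} (E : Set (Curve n)) (m : ℕ) : Prop :=
  ∃ L : List (Curve n), L.length ≤ m ∧ ∀ c ∈ E, ∃ d ∈ L, SameCurve c d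

/-- The set of points of a curve. -/
def curvePts {n : ℕ} (c : Curve n) : Set (Pt n) := ⋃ S ∈ c.segs, segPts S

-- ℝ³-specific part
def toPt3 (f : Fin 3 → ℝ) : Pt 3 := (WithLp.equiv 2 (Fin 3 → ℝ)).symm f

def p3 (a b c : ℤ) : Pt 3 := toPt3 ![(a : ℝ), (b : ℝ), (c : ℝ)]

/-- The vertices of the curve `C`. -/
def CList : List (Pt 3) :=
  [p3 0 0 0, p3 0 (-1) 0, p3 0 (-1) (-1), p3 0 0 (-1), p3 1 0 (-1),
   p3 1 (-1) (-1), p3 1 (-1) 0, p3 1 0 0, p3 2 0 0]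

/-- The block `ℬ₀` : six curves given by their lists of successive vertices. -/
def B0 : List (List (Pt 3)) :=
  [ CList,
    [p3 0 0 0, p3 0 0 1, p3 0 1 1, p3 0 1 0, p3 (-1) 1 0, p3 (-1) 1 1,
     p3 (-1) 0 1, p3 (-1) 0 0, p3 (-2) 0 0],
    [p3 0 0 0, p3 0 0 (-1), p3 (-1) 0 (-1), p3 (-1) 0 0, p3 (-1) 1 0,
     p3 (-1) 1 (-1), p3 0 1 (-1), p3 0 1 0, p3 0 2 0],
    [p3 0 0 0, p3 1 0 0, p3 1 0 1, p3 0 0 1, p3 0 (-1) 1, p3 1 (-1) 1,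
     p3 1 (-1) 0, p3 0 (-1) 0, p3 0 (-2) 0],
    [p3 0 0 0, p3 (-1) 0 0, p3 (-1) (-1) 0, p3 0 (-1) 0, p3 0 (-1) 1,
     p3 (-1) (-1) 1, p3 (-1) 0 1, p3 0 0 1, p3 0 0 2],
    [p3 0 0 0, p3 0 1 0, p3 1 1 0, p3 1 0 0, p3 1 0 (-1), p3 1 1 (-1),
     p3 0 1 (-1), p3 0 0 (-1), p3 0 0 (-2)] ]

def sigma3 : Pt 3 → Pt 3 := fun x => toPt3 ![x 0, -(x 1), -(x 2)]
def tau3 : Pt 3 → Pt 3 := fun x => toPt3 ![x 0, x 2, -(x 1)]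
def ups3 : Pt 3 → Pt 3 := fun x => toPt3 ![x 0, -(x 2), x 1]

/-- The four blocks `ℬ₀, ℬ₁, ℬ₂, ℬ₃`. -/
def blockLists : Fin 4 → List (List (Pt 3)) :=
  ![B0,
    B0.map (List.map fun p => p3 2 2 0 + sigma3 p),
    B0.map (List.map fun p => p3 2 0 2 + tau3 p),
    B0.map (List.map fun p => p3 0 2 2 + ups3 p)]

def listSegs (L : List (Pt 3)) : Set (Sym2 (Pt 3)) :=
  {S | ∃ j : ℕ, j + 1 < L.length ∧ S = s(L.getD j 0, L.getD (j + 1) 0)}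

def listConn (L : List (Pt 3)) (S T : Sym2 (Pt 3)) : Prop :=
  ∃ j : ℕ, j + 2 < L.length ∧
    ((S = s(L.getD j 0, L.getD (j + 1) 0) ∧ T = s(L.getD (j + 1) 0, L.getD (j + 2) 0)) ∨
     (T = s(L.getD j 0, L.getD (j + 1) 0) ∧ S = s(L.getD (j + 1) 0, L.getD (j + 2) 0)))

/-- The trace of the curve given by a list of successive vertices. -/
def listTrace (L : List (Pt 3)) : Trace 3 := ⟨listSegs L, listConn L⟩

/-- The trace of the covering `𝒞 = ⋃_{u ∈ ℤ³, 0 ≤ i ≤ 3} (4u + ℬ_i)`. -/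
def CTrace : Trace 3 where
  segs := {S | ∃ u : Pt 3, latt u ∧ ∃ (i : Fin 4), ∃ M ∈ blockLists i,
    S ∈ (Trace.transl ((4 : ℝ) • u) (listTrace M)).segs}
  conn := fun S T => ∃ u : Pt 3, latt u ∧ ∃ (i : Fin 4), ∃ M ∈ blockLists i,
    (Trace.transl ((4 : ℝ) • u) (listTrace M)).conn S T

open Classical in
/-- The permutation `θ` of `E` with `θ(e₁) = -e₂`, `θ(e₂) = -e₃`, `θ(e₃) = -e₁`
and `θ² = Id`. -/
def theta3 : Pt 3 → Pt 3 := fun u =>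
  if u = uvec 3 0 then -uvec 3 1
  else if u = -uvec 3 1 then uvec 3 0
  else if u = uvec 3 1 then -uvec 3 2
  else if u = -uvec 3 2 then uvec 3 1
  else if u = uvec 3 2 then -uvec 3 0
  else if u = -uvec 3 0 then uvec 3 2
  else u

/-- `R^θ`. -/
def Rtheta (R : Pt 3 → Pt 3 → Prop) : Pt 3 → Pt 3 → Prop :=
  fun u v => R (theta3 u) (theta3 v)

def Rx (P : ℕ → Set (Curve 3)) (x : Pt 3) : Pt 3 → Pt 3 → Prop :=
  fun u v => (hatTrace P).conn s(x, x + u) s(x, x + v)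

/-- Condition (P). -/
def SatP (P : ℕ → Set (Curve 3)) (R : Pt 3 → Pt 3 → Prop) : Prop :=
  ∃ x : Pt 3, (∀ i, x i = -2 ∨ x i = 0 ∨ x i = 2 ∨ x i = 4) ∧
    (¬ ∀ i, x i = 0 ∨ x i = 4) ∧ (Rx P x = R ∨ Rx P x = Rtheta R)

/-- The trace of `Ĉ_X`, the inductive limit of the sets `x_s + 𝒞^s`. -/
def hatXTrace (P : ℕ → Set (Curve 3)) (x : ℕ → Pt 3) : Trace 3 :=
  ⟨{S | ∃ s, 1 ≤ s ∧ S ∈ (Trace.transl (x s) (traceOf (P s))).segs},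
   fun S T => ∃ s, 1 ≤ s ∧ (Trace.transl (x s) (traceOf (P s))).conn S T⟩

/-- The curve `c` is equivalent to `C` (image of `C` by a positive isometry). -/
def EquivToC (c : Curve 3) : Prop :=
  ∃ f, PosIsom f ∧ curveTrace c = Trace.map f (listTrace CList)

/-- `x` is an endpoint of type `0` (resp. `1`) of the curve `c`, for `c`
equivalent to `C`. -/
def EndptType (c : Curve 3) (x : Pt 3) (ty : ℕ) : Prop :=
  ∃ f, PosIsom f ∧ curveTrace c = Trace.map f (listTrace CList) ∧
    x = f (if ty = 0 then p3 0 0 0 else p3 2 0 0)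

/-- Integer points. -/
abbrev Z3 := ℤ × ℤ × ℤ

/-- The canonical basis of `ℤ³`. -/
def unitZ : Fin 3 → Z3 := ![(1, 0, 0), (0, 1, 0), (0, 0, 1)]

/-- The lattice segments `[p, p + e_i]`, encoded as `(p, i)`. -/
abbrev Edge := Z3 × Fin 3

/-- The unordered pair of endpoints of an edge. -/
def Edge.ends (t : Edge) : Sym2 Z3 := s(t.1, t.1 + unitZ t.2)

/-- The block `ℬ₀` with integer coordinates. -/
def intB0 : List (List Z3) :=
  [ [(0, 0, 0), (0, -1, 0), (0, -1, -1), (0, 0, -1), (1, 0, -1),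
     (1, -1, -1), (1, -1, 0), (1, 0, 0), (2, 0, 0)],
    [(0, 0, 0), (0, 0, 1), (0, 1, 1), (0, 1, 0), (-1, 1, 0), (-1, 1, 1),
     (-1, 0, 1), (-1, 0, 0), (-2, 0, 0)],
    [(0, 0, 0), (0, 0, -1), (-1, 0, -1), (-1, 0, 0), (-1, 1, 0),
     (-1, 1, -1), (0, 1, -1), (0, 1, 0), (0, 2, 0)],
    [(0, 0, 0), (1, 0, 0), (1, 0, 1), (0, 0, 1), (0, -1, 1), (1, -1, 1),
     (1, -1, 0), (0, -1, 0), (0, -2, 0)],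
    [(0, 0, 0), (-1, 0, 0), (-1, -1, 0), (0, -1, 0), (0, -1, 1),
     (-1, -1, 1), (-1, 0, 1), (0, 0, 1), (0, 0, 2)],
    [(0, 0, 0), (0, 1, 0), (1, 1, 0), (1, 0, 0), (1, 0, -1), (1, 1, -1),
     (0, 1, -1), (0, 0, -1), (0, 0, -2)] ]

/-- The four blocks with integer coordinates. -/
def intBlock : Fin 4 → List (List Z3) :=
  ![intB0,
    intB0.map (List.map fun p => (2 + p.1, 2 - p.2.1, -p.2.2)),
    intB0.map (List.map fun p => (2 + p.1, p.2.2, 2 - p.2.1)),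
    intB0.map (List.map fun p => (p.1, 2 - p.2.2, 2 + p.2.1))]

/-- The table of the map `parent` on the edges with base point in `{0, 1, 2, 3}³`, in base
`256`: the digit of `((x, y, z), i)` is `(a + 1) + 4 (b + 1) + 16 (c + 1) + 64 j` when its
parent is `((a, b, c), j)`. -/
def parentCode : ℕ :=
  1150380917507147231898060078522141501269845530422275985504913241524122528431567854527581407190428642486523122257827540301014037888056779968486654253931795547236853095512675509199478400414742130918065556128286257340586581889099221262323047074570846654206025500003123925197702431209619259746078075020012193700033095098956964550306140598327002519354243841786367796321442280533706225854970602382546984728720291046818703832595314031903591536136445019921530415884830033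

/-- The edge `(a, i)` such that the given edge belongs to the curve of `𝒞` joining
`2 a` and `2 (a + e_i)`. -/
def parent (t : Edge) : Edge :=
  let d := parentCode / 256 ^ (((t.1.1 % 4 * 4 + t.1.2.1 % 4) * 4 + t.1.2.2 % 4).toNat * 3 + t.2)
    % 256
  ((((d % 4 : ℕ) : ℤ) - 1 + 2 * (t.1.1 / 4), ((d / 4 % 4 : ℕ) : ℤ) - 1 + 2 * (t.1.2.1 / 4),
    ((d / 16 % 4 : ℕ) : ℤ) - 1 + 2 * (t.1.2.2 / 4)), Fin.ofNat 3 (d / 64))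

/-- Translation of an edge. -/
def Edge.shift (w : Z3) (t : Edge) : Edge := (t.1 + w, t.2)

/-- The edge `t` meets the cube of center `x` and half side `h`. -/
def Meets (x : Z3) (h : ℤ) (t : Edge) : Prop :=
  (x.1 - h ≤ t.1.1 + (unitZ t.2).1 ∧ t.1.1 ≤ x.1 + h) ∧
  (x.2.1 - h ≤ t.1.2.1 + (unitZ t.2).2.1 ∧ t.1.2.1 ≤ x.2.1 + h) ∧
  (x.2.2 - h ≤ t.1.2.2 + (unitZ t.2).2.2 ∧ t.1.2.2 ≤ x.2.2 + h)

instance (x : Z3) (h : ℤ) (t : Edge) : Decidable (Meets x h t) := by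
  unfold Meets; infer_instance

/-- Vectors `w` such that the third ancestors of the edges `[2 w, 2 w + e_1]` represent all
edges modulo `2 ℤ³`. -/
def descents : List Z3 :=
  [(0, -1, 0), (0, 1, 0), (-2, 0, 0), (0, 0, 3), (-1, 0, 3), (-1, 0, 4),
   (1, 2, 0), (-1, 4, -1), (-1, 3, 0), (-1, 5, 1), (-1, 3, 4), (-1, 4, 3),
   (4, 0, 0), (2, 1, 0), (2, 0, 1), (3, 0, 4), (1, 0, 5), (4, 0, 3),
   (3, 4, -1), (4, 4, 0), (4, 3, 0), (4, 4, 3), (3, 4, 3), (3, 3, 4)]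

theorem Edge.exists_residue (m : ℕ) (hm : 0 < m) (t : Edge) : ∃ (a b c : Fin m) (w : Z3),
    t = Edge.shift ((m : ℤ) • w) (((a : ℕ), (b : ℕ), (c : ℕ)), t.2) := by
  obtain ⟨⟨x, y, z⟩, i⟩ := t
  have h : ∀ x : ℤ, ∃ a : Fin m, ((a : ℕ) : ℤ) = x % m := fun x => by
    have h0 : (0 : ℤ) < m := by exact_mod_cast hm
    have h1 := Int.emod_nonneg x h0.ne'
    have h2 := Int.emod_lt_of_pos x h0
    exact ⟨⟨(x % m).toNat, by omega⟩, by simp [h1]⟩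
  obtain ⟨a, ha⟩ := h x
  obtain ⟨b, hb⟩ := h y
  obtain ⟨c, hc⟩ := h z
  refine ⟨a, b, c, (x / m, y / m, z / m), ?_⟩
  simp [Edge.shift, ha, hb, hc, Int.emod_add_mul_ediv]

theorem parent_shift (w : Z3) (t : Edge) :
    parent (t.shift ((4 : ℤ) • w)) = (parent t).shift ((2 : ℤ) • w) := by
  obtain ⟨⟨x, y, z⟩, i⟩ := t
  obtain ⟨u, v, w⟩ := w
  simp [parent, Edge.shift, Int.add_mul_ediv_left]
  refine ⟨?_, ?_, ?_⟩ <;> ring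

theorem iterate_parent_shift (n : ℕ) (w : Z3) (t : Edge) :
    parent^[n] (t.shift ((2 ^ (n + 1) : ℤ) • w)) = (parent^[n] t).shift ((2 : ℤ) • w) := by
  induction n generalizing t with
  | zero => simp
  | succ n ih =>
    have : (2 ^ (n + 1 + 1) : ℤ) • w = (4 : ℤ) • ((2 ^ n : ℤ) • w) := by
      rw [smul_smul]; ring_nf
    rw [Function.iterate_succ_apply, Function.iterate_succ_apply, this, parent_shift, smul_smul,
      ← pow_succ', ih]

theorem exists_block_residue : ∀ (a b c : Fin 4) (i : Fin 3),
    ∃ k, ∃ L ∈ intBlock k,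
      ∃ u ∈ [((if (L.getD 0 0).1 = 0 then (a : ℤ) / 2 else 0,
        if (L.getD 0 0).2.1 = 0 then (b : ℤ) / 2 else 0,
        if (L.getD 0 0).2.2 = 0 then (c : ℤ) / 2 else 0) : Z3)],
      let w := (4 : ℤ) • u
      let t : Edge := (((a : ℕ), (b : ℕ), (c : ℕ)), i)
      s(L.getD 0 0 + w, L.getD 8 0 + w) =
        s((2 : ℤ) • (parent t).1, (2 : ℤ) • ((parent t).1 + unitZ (parent t).2)) ∧
      ∃ j : Fin 8, s(L.getD j 0 + w, L.getD (j + 1) 0 + w) = t.ends := by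
  decide +kernel

theorem parent_bounds_residue : ∀ (a b c : Fin 4) (i : Fin 3),
    let t : Edge := (((a : ℕ), (b : ℕ), (c : ℕ)), i)
    let A := parent t
    (2 * A.1.1 - 1 ≤ t.1.1 ∧ t.1.1 + (unitZ t.2).1 ≤ 2 * (A.1.1 + (unitZ A.2).1) + 1) ∧
    (2 * A.1.2.1 - 1 ≤ t.1.2.1 ∧
      t.1.2.1 + (unitZ t.2).2.1 ≤ 2 * (A.1.2.1 + (unitZ A.2).2.1) + 1) ∧
    (2 * A.1.2.2 - 1 ≤ t.1.2.2 ∧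
      t.1.2.2 + (unitZ t.2).2.2 ≤ 2 * (A.1.2.2 + (unitZ A.2).2.2) + 1) := by
  decide +kernel

theorem intBlock_interior : ∀ k, ∀ L ∈ intBlock k, L.length = 9 ∧ ∀ j : Fin 7,
    L.getD j 0 ≠ L.getD (j + 2) 0 ∧
    ((L.getD (j + 1) 0).1 % 2 = 1 ∨ (L.getD (j + 1) 0).2.1 % 2 = 1 ∨
      (L.getD (j + 1) 0).2.2 % 2 = 1) := by
  decide +kernel

theorem exists_descent : ∀ (a b c : Fin 2) (i : Fin 3), ∃ w ∈ descents,
    parent^[3] ((2 : ℤ) • w, 0) = ((((a : ℕ) : ℤ), ((b : ℕ) : ℤ), ((c : ℕ) : ℤ)), i) := by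
  decide +kernel

theorem parent_five_residue : ∀ (i : Fin 3) (a b c : Fin 4),
    let x : Z3 := (5, -12, -8)
    let t : Edge := (x - (1, 1, 1) - unitZ i + (((a : ℕ) : ℤ), ((b : ℕ) : ℤ), ((c : ℕ) : ℤ)), i)
    Meets x 1 t → parent^[5] t = ((0, 0, 0), 0) := by
  decide +kernel

theorem exists_block (t : Edge) : ∃ k, ∃ L ∈ intBlock k, ∃ u : Z3,
    s(L.getD 0 0 + (4 : ℤ) • u, L.getD 8 0 + (4 : ℤ) • u) =
        s((2 : ℤ) • (parent t).1, (2 : ℤ) • ((parent t).1 + unitZ (parent t).2)) ∧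
      ∃ j : Fin 8, s(L.getD j 0 + (4 : ℤ) • u, L.getD (j + 1) 0 + (4 : ℤ) • u) = t.ends := by
  obtain ⟨a, b, c, w, ht⟩ := t.exists_residue 4 (by norm_num)
  obtain ⟨k, L, hL, u, -, h1, j, h2⟩ := exists_block_residue a b c t.2
  refine ⟨k, L, hL, u + w, ?_, j, ?_⟩
  · rw [ht]
    push_cast
    rw [parent_shift]
    have := congrArg (Sym2.map (· + (4 : ℤ) • w)) h1
    simp only [Sym2.map_mk, Edge.shift] at this ⊢
    convert this using 2 <;> ext <;> simp <;> ring
  · rw [ht]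
    have := congrArg (Sym2.map (· + (4 : ℤ) • w)) h2
    simp only [Sym2.map_mk, Edge.shift, Edge.ends] at this ⊢
    convert this using 2 <;> ext <;> simp <;> ring

theorem Meets.parent {x : Z3} {h : ℤ} {t : Edge} (ht : Meets ((2 : ℤ) • x) (2 * h) t) :
    Meets x h (parent t) := by
  obtain ⟨a, b, c, w, e⟩ := t.exists_residue 4 (by norm_num)
  have := parent_bounds_residue a b c t.2
  rw [e] at ht ⊢
  push_cast at ht ⊢
  rw [parent_shift]
  simp only [Meets, Edge.shift, Prod.fst_add, Prod.snd_add, Prod.smul_fst, Prod.smul_snd,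
    smul_eq_mul] at this ht ⊢
  omega

theorem parent_five {t : Edge} (ht : Meets (5, -12, -8) 1 t) :
    parent^[5] t = ((0, 0, 0), 0) := by
  have key := parent_five_residue t.2
  obtain ⟨⟨p₁, p₂, p₃⟩, i⟩ := t
  have hu : (0 ≤ (unitZ i).1 ∧ (unitZ i).1 ≤ 1) ∧ (0 ≤ (unitZ i).2.1 ∧ (unitZ i).2.1 ≤ 1) ∧
      (0 ≤ (unitZ i).2.2 ∧ (unitZ i).2.2 ≤ 1) := by
    fin_cases i <;> simp [unitZ]
  have hm := ht
  simp only [Meets] at hm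
  specialize key ⟨(p₁ - 5 + 1 + (unitZ i).1).toNat, by omega⟩
    ⟨(p₂ + 12 + 1 + (unitZ i).2.1).toNat, by omega⟩
    ⟨(p₃ + 8 + 1 + (unitZ i).2.2).toNat, by omega⟩
  have hp : ((((5, -12, -8) : Z3) - (1, 1, 1) - unitZ i +
      (((p₁ - 5 + 1 + (unitZ i).1).toNat : ℤ), ((p₂ + 12 + 1 + (unitZ i).2.1).toNat : ℤ),
        ((p₃ + 8 + 1 + (unitZ i).2.2).toNat : ℤ)), i) : Edge) = ((p₁, p₂, p₃), i) := by
    ext <;> simp <;> omega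
  simp only [hp] at key
  exact key ht

theorem exists_center_eight (t : Edge) :
    ∃ x, ∀ t', Meets x 1 t' → parent^[8] t' = t := by
  obtain ⟨a, b, c, w, e⟩ := t.exists_residue 2 (by norm_num)
  obtain ⟨v, -, hv⟩ := exists_descent a b c t.2
  refine ⟨(5, -12, -8) + (2 ^ (5 + 1) : ℤ) • (v + (8 : ℤ) • w), fun t' ht' => ?_⟩
  set y := (2 ^ (5 + 1) : ℤ) • (v + (8 : ℤ) • w) with hy
  have hs : t' = (t'.shift (-y)).shift y := by simp [Edge.shift]
  have hm : Meets (5, -12, -8) 1 (t'.shift (-y)) := by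
    simp only [Meets, Edge.shift, Prod.fst_add, Prod.snd_add, Prod.fst_neg, Prod.snd_neg] at ht' ⊢
    omega
  have h5 : parent^[5] t' = Edge.shift ((2 ^ (3 + 1) : ℤ) • w) ((2 : ℤ) • v, 0) := by
    rw [hs, hy, iterate_parent_shift, ← hy, parent_five hm]
    ext <;> simp [Edge.shift] <;> ring
  rw [show 8 = 3 + 5 from rfl, Function.iterate_add_apply, h5, iterate_parent_shift, hv, e]
  rfl

theorem exists_center (n : ℕ) (t : Edge) :
    ∃ x, ∀ t', Meets x (2 ^ n) t' → parent^[n + 8] t' = t := by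
  induction n with
  | zero => simpa using exists_center_eight t
  | succ n ih =>
    obtain ⟨x, hx⟩ := ih
    refine ⟨(2 : ℤ) • x, fun t' ht' => ?_⟩
    rw [add_right_comm, Function.iterate_succ_apply]
    exact hx _ (Meets.parent (by rwa [← pow_succ']))

open Relation

namespace Curve

variable {n : ℕ} {c : Curve n}

theorem isSeg_of_mem_segs {S : Sym2 (Pt n)} (hS : S ∈ c.segs) : IsSeg S := by
  obtain ⟨i, hi, hi', rfl⟩ := hS
  obtain ⟨j, h | h⟩ := c.step i hi hi'
  · exact ⟨c.v i, j, c.lattice i hi, by rw [h]⟩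
  · exact ⟨c.v (i + 1), j, c.lattice _ hi', by rw [h, sub_add_cancel, Sym2.eq_swap]⟩

theorem segs_nonempty (c : Curve n) : c.segs.Nonempty := by
  obtain ⟨i, hi, hi'⟩ := c.nontriv
  exact ⟨_, i, hi, hi', rfl⟩

theorem conn_symm {S T : Sym2 (Pt n)} (h : c.conn S T) : c.conn T S := by
  obtain ⟨i, h1, h2, h⟩ := h
  exact ⟨i, h1, h2, h.symm⟩

theorem mem_dom_of_conn {i : ℤ} (h1 : i - 1 ∈ c.dom) (h2 : i + 1 ∈ c.dom) : i ∈ c.dom :=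
  c.ordConn.out h1 h2 ⟨by omega, by omega⟩

theorem mem_segs_of_conn {S T : Sym2 (Pt n)} (h : c.conn S T) : S ∈ c.segs ∧ T ∈ c.segs := by
  obtain ⟨i, h1, h2, h⟩ := h
  have h0 := mem_dom_of_conn h1 h2
  have hp : s(c.v (i - 1), c.v i) ∈ c.segs := ⟨i - 1, h1, by simpa using h0, by simp⟩
  have hn : s(c.v i, c.v (i + 1)) ∈ c.segs := ⟨i, h0, h2, rfl⟩
  rcases h with ⟨rfl, rfl⟩ | ⟨rfl, rfl⟩
  exacts [⟨hp, hn⟩, ⟨hn, hp⟩]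

theorem eqvGen_conn {S T : Sym2 (Pt n)} (hS : S ∈ c.segs) (hT : T ∈ c.segs) :
    EqvGen c.conn S T := by
  have key : ∀ i j : ℤ, i ≤ j → i ∈ c.dom → j + 1 ∈ c.dom →
      EqvGen c.conn s(c.v i, c.v (i + 1)) s(c.v j, c.v (j + 1)) := by
    intro i j hij hi
    induction j, hij using Int.leInduction with
    | base => exact fun _ => .refl _
    | succ j hij ih =>
      intro hj
      have hj' : j ∈ c.dom := c.ordConn.out hi hj ⟨hij, by omega⟩
      have hj1 : j + 1 ∈ c.dom := c.ordConn.out hi hj ⟨by omega, by omega⟩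
      exact (ih hj1).trans _ _ _ (.rel _ _ ⟨j + 1, by simpa using hj', hj, .inl (by simp)⟩)
  obtain ⟨i, hi, hi', rfl⟩ := hS
  obtain ⟨j, hj, hj', rfl⟩ := hT
  rcases le_total i j with h | h
  · exact key i j h hi hj'
  · exact (key j i h hj hi').symm

theorem endSegAt_mem_segs {p : Pt n} {S : Sym2 (Pt n)} (h : c.endSegAt p S) : S ∈ c.segs := by
  obtain ⟨i, hi, rfl, ⟨-, h, rfl⟩ | ⟨-, h, rfl⟩⟩ := h
  · exact ⟨i, hi, h, rfl⟩
  · exact ⟨i - 1, h, by simpa using hi, by simp⟩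

theorem IsEndpt.exists_endSegAt {p : Pt n} (h : c.IsEndpt p) : ∃ S, c.endSegAt p S := by
  obtain ⟨i, hi, rfl, h⟩ := h
  obtain ⟨k, hk, hk'⟩ := c.nontriv
  rcases le_or_gt i k with hik | hik
  · have h1 : i + 1 ∈ c.dom := c.ordConn.out hi hk' ⟨by omega, by omega⟩
    exact ⟨_, i, hi, rfl, .inl ⟨h.resolve_right (not_not.2 h1), h1, rfl⟩⟩
  · have h1 : i - 1 ∈ c.dom := c.ordConn.out hk hi ⟨by omega, by omega⟩
    exact ⟨_, i, hi, rfl, .inr ⟨h.resolve_left (not_not.2 h1), h1, rfl⟩⟩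

theorem exists_vertex_of_mem_segs {p q : Pt n} (h : s(p, q) ∈ c.segs) :
    ∃ i ∈ c.dom, c.v i = p := by
  obtain ⟨i, hi, hi', h⟩ := h
  rcases Sym2.eq_iff.1 h with ⟨rfl, -⟩ | ⟨rfl, -⟩
  exacts [⟨_, hi, rfl⟩, ⟨_, hi', rfl⟩]

end Curve

theorem DisjSA.mem_segs_iff {n : ℕ} {E : Set (Curve n)} (hE : DisjSA E) {c : Curve n}
    (hc : c ∈ E) {S T : Sym2 (Pt n)} (h : EqvGen (traceOf E).conn S T) :
    S ∈ c.segs ↔ T ∈ c.segs := by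
  induction h with
  | rel S T h =>
    obtain ⟨d, hd, h⟩ := h
    obtain ⟨hS, hT⟩ := Curve.mem_segs_of_conn h
    constructor <;> intro hm <;> by_contra hn
    · have hcd : ¬ SameCurve c d := fun e => hn (e.1 ▸ hT)
      exact hE.2 c hc d hd hcd S hm hS
    · have hcd : ¬ SameCurve c d := fun e => hn (e.1 ▸ hS)
      exact hE.2 c hc d hd hcd T hm hT
  | refl => rfl
  | symm _ _ _ ih => exact ih.symm
  | trans _ _ _ _ _ ih₁ ih₂ => exact ih₁.trans ih₂

section Powers

variable {n k l : ℕ} {A : Set (Curve n)} {P : ℕ → Set (Curve n)}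

/-- `S` is a segment of a curve of `A` which replaces the segment `T`. -/
def Replaces (k : ℕ) (A : Set (Curve n)) (T S : Sym2 (Pt n)) : Prop :=
  ∃ a b, T = s(a, b) ∧ ∃ c ∈ A, c.IsEndpt ((k : ℝ) • a) ∧ c.IsEndpt ((k : ℝ) • b) ∧ S ∈ c.segs

theorem Replaces.exists_curve {a b : Pt n} {S : Sym2 (Pt n)} (h : Replaces k A s(a, b) S) :
    ∃ c ∈ A, c.IsEndpt ((k : ℝ) • a) ∧ c.IsEndpt ((k : ℝ) • b) ∧ S ∈ c.segs := by
  obtain ⟨a', b', e, c, hc, h1, h2, hS⟩ := h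
  rcases Sym2.eq_iff.1 e with ⟨rfl, rfl⟩ | ⟨rfl, rfl⟩
  exacts [⟨c, hc, h1, h2, hS⟩, ⟨c, hc, h2, h1, hS⟩]

theorem inLat_smul {x : Pt n} (hx : latt x) : latt ((k : ℝ) • x) ∧ inLat k ((k : ℝ) • x) := by
  constructor <;> intro i <;> obtain ⟨m, hm⟩ := hx i
  · exact ⟨k * m, by simp [hm]⟩
  · exact ⟨m, by simp [hm]⟩

theorem SatH.exists_replaces (hA : SatH A k l) {T : Sym2 (Pt n)} (hT : IsSeg T) :
    ∃ S, Replaces k A T S := by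
  obtain ⟨x, i, hx, rfl⟩ := hT
  obtain ⟨⟨c, hc, h1, h2⟩, -⟩ :=
    hA.2.2.2.2.2.1 ((k : ℝ) • x) i (inLat_smul hx).1 (inLat_smul hx).2
  obtain ⟨S, hS⟩ := c.segs_nonempty
  exact ⟨S, x, _, rfl, c, hc, h1, by rwa [smul_add], hS⟩

theorem SatH.sameCurve (hA : SatH A k l) {a b : Pt n} (hT : IsSeg s(a, b)) {c d : Curve n}
    (hc : c ∈ A) (hd : d ∈ A) (hca : c.IsEndpt ((k : ℝ) • a)) (hcb : c.IsEndpt ((k : ℝ) • b))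
    (hda : d.IsEndpt ((k : ℝ) • a)) (hdb : d.IsEndpt ((k : ℝ) • b)) : SameCurve c d := by
  obtain ⟨x, i, hx, e⟩ := hT
  have key := (hA.2.2.2.2.2.1 ((k : ℝ) • x) i (inLat_smul hx).1 (inLat_smul hx).2).2 c hc d hd
  rw [← smul_add] at key
  rcases Sym2.eq_iff.1 e with ⟨rfl, rfl⟩ | ⟨rfl, rfl⟩
  exacts [key hca hcb hda hdb, key hcb hca hdb hda]

theorem eqvGen_conn_conv (hP : PowersOf A k P) {s : ℕ} {a b : Pt n}
    (hT : s(a, b) ∈ (traceOf (P s)).segs) {c : Curve n} (hc : c ∈ A)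
    (hca : c.IsEndpt ((k : ℝ) • a)) (hcb : c.IsEndpt ((k : ℝ) • b))
    {S S' : Sym2 (Pt n)} (hS : S ∈ c.segs) (hS' : S' ∈ c.segs) :
    EqvGen (traceOf (P (s + 1))).conn S S' := by
  rw [hP.2.2 s]
  exact (Curve.eqvGen_conn hS hS').mono fun _ _ h => .inl ⟨a, b, hT, c, hc, hca, hcb, h⟩

theorem eqvGen_conn_of_consecutive (hP : PowersOf A k P) {s : ℕ} {a b d : Pt n}
    (h : (traceOf (P s)).conn s(a, b) s(b, d)) {S S' : Sym2 (Pt n)}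
    (hS : Replaces k A s(a, b) S) (hS' : Replaces k A s(b, d) S') :
    EqvGen (traceOf (P (s + 1))).conn S S' := by
  obtain ⟨c, hc, hca, hcb, hS⟩ := hS.exists_curve
  obtain ⟨c', hc', hcb', hcd', hS'⟩ := hS'.exists_curve
  obtain ⟨U, hU⟩ := hcb.exists_endSegAt
  obtain ⟨U', hU'⟩ := hcb'.exists_endSegAt
  obtain ⟨e, he, h'⟩ := id h
  have hm := Curve.mem_segs_of_conn h'
  have h1 := eqvGen_conn_conv hP ⟨e, he, hm.1⟩ hc hca hcb hS (Curve.endSegAt_mem_segs hU)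
  have h2 := eqvGen_conn_conv hP ⟨e, he, hm.2⟩ hc' hcb' hcd' (Curve.endSegAt_mem_segs hU') hS'
  refine (h1.trans _ _ _ (.rel _ _ ?_)).trans _ _ _ h2
  rw [hP.2.2 s]
  exact .inr ⟨a, b, d, h, c, hc, c', hc', hca, hcb, hcb', hcd', .inl ⟨hU, hU'⟩⟩

theorem eqvGen_conn_succ (hP : PowersOf A k P) (hA : SatH A k l) {s : ℕ} {T T' : Sym2 (Pt n)}
    (h : EqvGen (traceOf (P s)).conn T T') :
    (T ∈ (traceOf (P s)).segs ↔ T' ∈ (traceOf (P s)).segs) ∧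
      (T ∈ (traceOf (P s)).segs → ∀ S S', Replaces k A T S → Replaces k A T' S' →
        EqvGen (traceOf (P (s + 1))).conn S S') := by
  induction h with
  | rel T T' h =>
    obtain ⟨d, hd, h'⟩ := id h
    have hm := Curve.mem_segs_of_conn h'
    refine ⟨iff_of_true ⟨d, hd, hm.1⟩ ⟨d, hd, hm.2⟩, fun _ S S' hS hS' => ?_⟩
    obtain ⟨i, -, -, ⟨rfl, rfl⟩ | ⟨rfl, rfl⟩⟩ := id h'
    · exact eqvGen_conn_of_consecutive hP h hS hS'
    · exact (eqvGen_conn_of_consecutive hP ⟨d, hd, Curve.conn_symm h'⟩ hS' hS).symm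
  | refl T =>
    refine ⟨.rfl, fun hT S S' hS hS' => ?_⟩
    induction T with | _ a b => ?_
    obtain ⟨c, hc, hca, hcb, hS⟩ := hS.exists_curve
    obtain ⟨c', hc', hca', hcb', hS'⟩ := hS'.exists_curve
    obtain ⟨d, hd, hTd⟩ := id hT
    have e := hA.sameCurve (Curve.isSeg_of_mem_segs hTd) hc hc' hca hcb hca' hcb'
    exact eqvGen_conn_conv hP hT hc hca hcb hS (e.1 ▸ hS')
  | symm T T' _ ih =>
    exact ⟨ih.1.symm, fun hT S S' hS hS' => (ih.2 (ih.1.2 hT) S' S hS' hS).symm⟩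
  | trans T T' T'' _ _ ih₁ ih₂ =>
    refine ⟨ih₁.1.trans ih₂.1, fun hT S S' hS hS' => ?_⟩
    obtain ⟨d, hd, hTd⟩ := ih₁.1.1 hT
    obtain ⟨U, hU⟩ := hA.exists_replaces (Curve.isSeg_of_mem_segs hTd)
    exact (ih₁.2 hT S U hS hU).trans _ _ _ (ih₂.2 ⟨d, hd, hTd⟩ U S' hU hS')

end Powers

section Bridge

/-- The inclusion of `ℤ³` in `ℝ³`. -/
def ofZ (p : Z3) : Pt 3 := p3 p.1 p.2.1 p.2.2

/-- The lattice segment associated with an edge. -/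
def toSeg (t : Edge) : Sym2 (Pt 3) := t.ends.map ofZ

@[simp] theorem p3_apply (a b c : ℤ) (i : Fin 3) :
    p3 a b c i = (![(a : ℝ), (b : ℝ), (c : ℝ)]) i := rfl

@[simp] theorem toPt3_apply (f : Fin 3 → ℝ) (i : Fin 3) : toPt3 f i = f i := rfl

theorem ofZ_add (p q : Z3) : ofZ (p + q) = ofZ p + ofZ q := by
  ext i; fin_cases i <;> simp [ofZ]

theorem ofZ_zero : ofZ 0 = 0 := by
  ext i; fin_cases i <;> simp [ofZ]

theorem ofZ_smul (m : ℤ) (p : Z3) : ofZ (m • p) = (m : ℝ) • ofZ p := by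
  ext i; fin_cases i <;> simp [ofZ]

theorem ofZ_injective : Function.Injective ofZ := by
  intro p q h
  have h0 := congrArg (· 0) h
  have h1 := congrArg (· 1) h
  have h2 := congrArg (· 2) h
  simp [ofZ] at h0 h1 h2
  exact Prod.ext h0 (Prod.ext h1 h2)

theorem ofZ_unitZ (i : Fin 3) : ofZ (unitZ i) = uvec 3 i := by
  ext j; fin_cases i <;> fin_cases j <;> simp [ofZ, unitZ, uvec]

theorem latt_ofZ (p : Z3) : latt (ofZ p) := by
  intro i
  fin_cases i
  exacts [⟨p.1, rfl⟩, ⟨p.2.1, rfl⟩, ⟨p.2.2, rfl⟩]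

theorem exists_ofZ_of_latt {p : Pt 3} (h : latt p) : ∃ q, p = ofZ q := by
  obtain ⟨a, ha⟩ := h 0
  obtain ⟨b, hb⟩ := h 1
  obtain ⟨c, hc⟩ := h 2
  refine ⟨(a, b, c), ?_⟩
  ext i; fin_cases i <;> simp [ofZ, ha, hb, hc]

theorem toSeg_eq (t : Edge) : toSeg t = s(ofZ t.1, ofZ t.1 + uvec 3 t.2) := by
  simp [toSeg, Edge.ends, ofZ_add, ofZ_unitZ]

theorem isSeg_toSeg (t : Edge) : IsSeg (toSeg t) :=
  ⟨_, _, latt_ofZ t.1, toSeg_eq t⟩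

theorem IsSeg.exists_toSeg {S : Sym2 (Pt 3)} (h : IsSeg S) : ∃ t, S = toSeg t := by
  obtain ⟨x, i, hx, rfl⟩ := h
  obtain ⟨q, rfl⟩ := exists_ofZ_of_latt hx
  exact ⟨(q, i), (toSeg_eq (q, i)).symm⟩

theorem blockLists_eq (k : Fin 4) : blockLists k = (intBlock k).map (List.map ofZ) := by
  have h0 : B0 = intB0.map (List.map ofZ) := rfl
  have key : ∀ (f : Pt 3 → Pt 3) (g : Z3 → Z3), (∀ p, f (ofZ p) = ofZ (g p)) →
      B0.map (List.map f) = (intB0.map (List.map g)).map (List.map ofZ) := by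
    intro f g hfg
    have e : f ∘ ofZ = ofZ ∘ g := funext hfg
    simp only [h0, List.map_map]
    congr 1
    funext L
    simp [e]
  fin_cases k
  · exact h0
  all_goals
    refine key _ _ fun p => ?_
    ext i
    fin_cases i <;> simp [ofZ, sigma3, tau3, ups3, sub_eq_add_neg]

theorem getD_map_ofZ (L : List Z3) (j : ℕ) : (L.map ofZ).getD j 0 = ofZ (L.getD j 0) := by
  rw [← ofZ_zero, List.getD_map]

theorem Meets.of_segPts {x : Z3} {h : ℕ} {t : Edge}
    (ht : (segPts (toSeg t) ∩ cube (ofZ x) h).Nonempty) : Meets x h t := by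
  obtain ⟨p, ⟨a, b, e, r, h0, h1, rfl⟩, hp⟩ := ht
  have key : ∀ i, ofZ x i - h ≤ ofZ (t.1 + unitZ t.2) i ∧ ofZ t.1 i ≤ ofZ x i + h := by
    intro i
    have hu : 0 ≤ ofZ (unitZ t.2) i := by
      rw [ofZ_unitZ]
      simp only [uvec, PiLp.single_apply]
      split_ifs <;> norm_num
    have hpi := hp i
    simp only [PiLp.add_apply, PiLp.smul_apply, PiLp.sub_apply, smul_eq_mul] at hpi
    simp only [toSeg, Edge.ends, Sym2.map_mk] at e
    rcases Sym2.eq_iff.1 e with ⟨rfl, rfl⟩ | ⟨rfl, rfl⟩ <;>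
      simp only [ofZ_add, PiLp.add_apply] at hpi ⊢ <;> constructor <;> nlinarith
  have k0 := key 0
  have k1 := key 1
  have k2 := key 2
  simp only [ofZ, p3_apply, Matrix.cons_val] at k0 k1 k2
  exact ⟨by exact_mod_cast k0, by exact_mod_cast k1, by exact_mod_cast k2⟩

end Bridge

section Covering

variable {C3 : Set (Curve 3)} {P : ℕ → Set (Curve 3)}

/-- The vertex of index `j` of the translate of the list `L` by `4 u`. -/
def blockVertex (L : List Z3) (u : Z3) (j : ℕ) : Pt 3 := ofZ (L.getD j 0 + (4 : ℤ) • u)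

theorem getD_map_add_smul (L : List Z3) (u : Z3) (j : ℕ) :
    (L.map ofZ).getD j 0 + (4 : ℝ) • ofZ u = blockVertex L u j := by
  rw [getD_map_ofZ, blockVertex, ofZ_add, ofZ_smul]
  norm_num

theorem CTrace_segs_blockVertex {k : Fin 4} {L : List Z3} (hL : L ∈ intBlock k) (u : Z3) {j : ℕ}
    (hj : j < 8) : s(blockVertex L u j, blockVertex L u (j + 1)) ∈ CTrace.segs := by
  have hl := (intBlock_interior k L hL).1
  refine ⟨ofZ u, latt_ofZ u, k, L.map ofZ, ?_, s((L.map ofZ).getD j 0, (L.map ofZ).getD (j + 1) 0),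
    ⟨j, by simp [hl]; omega, rfl⟩, ?_⟩
  · rw [blockLists_eq]
    exact List.mem_map_of_mem hL
  · simp only [Sym2.map_mk, getD_map_add_smul]

theorem CTrace_conn_blockVertex {k : Fin 4} {L : List Z3} (hL : L ∈ intBlock k) (u : Z3) {j : ℕ}
    (hj : j < 7) : CTrace.conn s(blockVertex L u j, blockVertex L u (j + 1))
      s(blockVertex L u (j + 1), blockVertex L u (j + 2)) := by
  have hl := (intBlock_interior k L hL).1
  refine ⟨ofZ u, latt_ofZ u, k, L.map ofZ, ?_, s((L.map ofZ).getD j 0, (L.map ofZ).getD (j + 1) 0),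
    s((L.map ofZ).getD (j + 1) 0, (L.map ofZ).getD (j + 2) 0),
    ⟨j, by simp [hl]; omega, .inl ⟨rfl, rfl⟩⟩, ?_, ?_⟩
  · rw [blockLists_eq]
    exact List.mem_map_of_mem hL
  all_goals simp only [Sym2.map_mk, getD_map_add_smul]

theorem CTrace_conn_imp {S T : Sym2 (Pt 3)} (h : CTrace.conn S T) :
    ∃ k, ∃ L ∈ intBlock k, ∃ u, ∃ j < 7,
      (S = s(blockVertex L u j, blockVertex L u (j + 1)) ∧
        T = s(blockVertex L u (j + 1), blockVertex L u (j + 2))) ∨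
      (T = s(blockVertex L u j, blockVertex L u (j + 1)) ∧
        S = s(blockVertex L u (j + 1), blockVertex L u (j + 2))) := by
  obtain ⟨u, hu, k, M, hM, S, T, ⟨j, hj, h⟩, rfl, rfl⟩ := h
  obtain ⟨u, rfl⟩ := exists_ofZ_of_latt hu
  rw [blockLists_eq] at hM
  obtain ⟨L, hL, rfl⟩ := List.mem_map.1 hM
  have hl := (intBlock_interior k L hL).1
  refine ⟨k, L, hL, u, j, by simp [hl] at hj; omega, ?_⟩
  rcases h with ⟨rfl, rfl⟩ | ⟨rfl, rfl⟩ <;>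
    simp only [Sym2.map_mk, getD_map_add_smul, and_self, true_or, or_true]

/-- Two connected segments of `𝒞` do not meet at a point of `2 ℤ³`. -/
theorem not_CTrace_conn_even {a b : Pt 3} {q : Z3} (hab : a ≠ b) :
    ¬ CTrace.conn s(a, ofZ ((2 : ℤ) • q)) s(ofZ ((2 : ℤ) • q), b) := by
  intro h
  obtain ⟨k, L, hL, u, j, hj, h⟩ := CTrace_conn_imp h
  obtain ⟨hne, hodd⟩ := (intBlock_interior k L hL).2 ⟨j, hj⟩
  have hne' : blockVertex L u j ≠ blockVertex L u (j + 2) := fun e =>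
    hne (add_right_cancel (ofZ_injective e))
  have key : ofZ ((2 : ℤ) • q) = blockVertex L u (j + 1) := by
    simp only [Sym2.eq_iff] at h
    grind
  have e := ofZ_injective key
  have e1 := congrArg (·.1) e
  have e2 := congrArg (·.2.1) e
  have e3 := congrArg (·.2.2) e
  simp only [Prod.smul_fst, Prod.smul_snd, Prod.fst_add, Prod.snd_add, smul_eq_mul] at e1 e2 e3
  simp only at hodd
  omega

theorem isEndpt_of_even (hC3 : traceOf C3 = CTrace) {c : Curve 3} (hc : c ∈ C3) {i : ℤ}
    (hi : i ∈ c.dom) {q : Z3} (hq : c.v i = ofZ ((2 : ℤ) • q)) : c.IsEndpt (c.v i) := by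
  refine ⟨i, hi, rfl, ?_⟩
  by_contra! h
  have hconn : (traceOf C3).conn s(c.v (i - 1), c.v i) s(c.v i, c.v (i + 1)) :=
    ⟨c, hc, i, h.1, h.2, .inl ⟨rfl, rfl⟩⟩
  rw [hC3, hq] at hconn
  exact not_CTrace_conn_even (c.noback i h.1 h.2).symm hconn

theorem replaces_parent (hC3 : traceOf C3 = CTrace) (hE : DisjSA C3) (t : Edge) :
    Replaces 2 C3 (toSeg (parent t)) (toSeg t) := by
  obtain ⟨k, L, hL, u, hends, j, hj⟩ := exists_block t
  have ht : toSeg t = s(blockVertex L u j, blockVertex L u (j + 1)) := by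
    rw [toSeg, ← hj]; rfl
  obtain ⟨c, hc, hcj⟩ : toSeg t ∈ (traceOf C3).segs := by
    rw [hC3, ht]
    exact CTrace_segs_blockVertex hL u j.2
  have step : ∀ i < 7, s(blockVertex L u i, blockVertex L u (i + 1)) ∈ c.segs ↔
      s(blockVertex L u (i + 1), blockVertex L u (i + 2)) ∈ c.segs := fun i hi => by
    refine hE.mem_segs_iff hc (.rel _ _ ?_)
    rw [hC3]
    exact CTrace_conn_blockVertex hL u hi
  have hzero : ∀ i ≤ 7, s(blockVertex L u 0, blockVertex L u 1) ∈ c.segs ↔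
      s(blockVertex L u i, blockVertex L u (i + 1)) ∈ c.segs := by
    intro i
    induction i with
    | zero => exact fun _ => .rfl
    | succ i ih => exact fun hi => (ih (by omega)).trans (step i (by omega))
  rw [ht] at hcj
  have h0 := (hzero j (by omega)).2 hcj
  have h7 := (hzero 7 le_rfl).1 h0
  rw [Sym2.eq_swap] at h7
  have hv : ∀ q b, s(ofZ ((2 : ℤ) • q), b) ∈ c.segs → c.IsEndpt (((2 : ℕ) : ℝ) • ofZ q) := by
    intro q b hq
    obtain ⟨i, hi, hiq⟩ := Curve.exists_vertex_of_mem_segs hq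
    have := isEndpt_of_even hC3 hc hi hiq
    rw [hiq, ofZ_smul] at this
    exact_mod_cast this
  refine ⟨ofZ (parent t).1, ofZ ((parent t).1 + unitZ (parent t).2), rfl, c, hc, ?_, ?_,
    ht ▸ hcj⟩
  all_goals
    rcases Sym2.eq_iff.1 hends with ⟨e0, e8⟩ | ⟨e0, e8⟩
    all_goals
      simp only [blockVertex, e0, e8] at h0 h7
      first
      | exact hv _ _ h0
      | exact hv _ _ h7

theorem toSeg_mem_segs (hC3 : traceOf C3 = CTrace) (hE : DisjSA C3) (hP : PowersOf C3 2 P)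
    (s : ℕ) (t : Edge) : toSeg t ∈ (traceOf (P s)).segs := by
  induction s generalizing t with
  | zero =>
    rw [hP.2.1]
    exact isSeg_toSeg t
  | succ s ih =>
    obtain ⟨a, b, e, h⟩ := replaces_parent hC3 hE t
    rw [hP.2.2 s]
    exact ⟨a, b, e ▸ ih (parent t), h⟩

theorem eqvGen_conn_of_iterate_parent_eq (hC3 : traceOf C3 = CTrace) (hH : SatH C3 2 4)
    (hP : PowersOf C3 2 P) (s : ℕ) {t t' : Edge} (h : parent^[s] t = parent^[s] t') :
    EqvGen (traceOf (P s)).conn (toSeg t) (toSeg t') := by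
  have hE := hH.2.2.2.1.1
  induction s generalizing t t' with
  | zero =>
    obtain rfl : t = t' := h
    exact .refl _
  | succ s ih =>
    exact (eqvGen_conn_succ hP hH (ih h)).2 (toSeg_mem_segs hC3 hE hP s _) _ _
      (replaces_parent hC3 hE t) (replaces_parent hC3 hE t')

end Covering

/-- Proposition 2.5: for each integer `s ≥ 8`, each curve of `𝒞^s`
covers some cube `P_{x,2^{s-8}}` with `x ∈ ℤ³`. -/
theorem statement12 (C3 : Set (Curve 3)) (hC3 : traceOf C3 = CTrace)
    (hH : SatH C3 2 4) (P : ℕ → Set (Curve 3)) (hP : PowersOf C3 2 P) :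
    ∀ s : ℕ, 8 ≤ s → ∀ c ∈ P s, ∃ x : Pt 3, latt x ∧
      CurveCovers c (cube x (2 ^ (s - 8))) := by
  intro s hs c hc
  obtain ⟨n, rfl⟩ := Nat.exists_eq_add_of_le' hs
  obtain ⟨S₀, hS₀⟩ := c.segs_nonempty
  obtain ⟨t₀, rfl⟩ := (Curve.isSeg_of_mem_segs hS₀).exists_toSeg
  obtain ⟨x, hx⟩ := exists_center n (parent^[n + 8] t₀)
  refine ⟨ofZ x, latt_ofZ x, fun S hS hmeet => ?_⟩
  obtain ⟨t, rfl⟩ := hS.exists_toSeg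
  rw [Nat.add_sub_cancel] at hmeet
  have ht := hx t (by exact_mod_cast Meets.of_segPts hmeet)
  exact ((hP.1 _).mem_segs_iff hc
    (eqvGen_conn_of_iterate_parent_eq hC3 hH hP _ ht)).2 hS₀

end
end Folding
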